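/- Let (Θ,d) be a complete separable metric space with d ≤ 1, and for each n let (X_n, 𝒳_n, P_n) be a probability space, M_n a probability transition kernel from X_n to Θ^ℕ₀ such that M_n(x,·) is shift-stationary with invariant probability transition kernel Π_n(x,·) for P_n-a.e. x, and let e be the sequence of empirical distribution maps. Let M_∞ be a (non-random) shift-stationary and ergodic probability measure on Θ^ℕ₀ with invariant probability measure Π_∞. If ∫ w_∞(M_n(x_n,·), M_∞) P_n(dx_n) → 0 as n → ∞, where w_∞ is the bounded Lipschitz metric induced by d_∞(θ¹_∞,θ²_∞) = Σ_i 2^{−i−1} d(θ¹(i),θ²(i)), then for every sequence m_n → ∞, R_{m_n}(M_n, Π_n) := ∫_{X_n} ∫_{Θ^ℕ₀} w(e_{m_n}(θ(0),…,θ(m_n−1)), Π_n(x_n,·)) M_n(x_n, dθ_∞) P_n(dx_n) → 0. -/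

import Mathlib

open MeasureTheory ProbabilityTheory Filter Topology Matrix ENNReal

/-- The class `BL₁(Θ)` of Borel measurable functions `f : Θ → ℝ` with
`|f s - f t| ≤ d(s,t)` for all `s, t`. -/
def BLone (Θ : Type*) [MeasurableSpace Θ] [PseudoMetricSpace Θ] : Set (Θ → ℝ) :=
  {f | Measurable f ∧ ∀ s t : Θ, |f s - f t| ≤ dist s t}

/-- The bounded Lipschitz distance `w(μ,ν) = sup_{f ∈ BL₁} |∫ f dμ - ∫ f dν|`. -/
noncomputable def blDist {Θ : Type*} [MeasurableSpace Θ] [PseudoMetricSpace Θ]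
    (μ ν : Measure Θ) : ℝ :=
  ⨆ f ∈ BLone Θ, |∫ x, f x ∂μ - ∫ x, f x ∂ν|

/-- The empirical distribution `e_m(θ(0),…,θ(m-1)) = (1/m) ∑_{i<m} δ_{θ(i)}`. -/
noncomputable def emp {Θ : Type*} [MeasurableSpace Θ] (θ : ℕ → Θ) (m : ℕ) : Measure Θ :=
  (m : ℝ≥0∞)⁻¹ • ∑ i ∈ Finset.range m, Measure.dirac (θ i)

/-- The shift `T(θ(0),θ(1),…) = (θ(1),θ(2),…)` on `Θ^{ℕ₀}`. -/
def shift {Θ : Type*} (θ : ℕ → Θ) : ℕ → Θ := fun i => θ (i + 1)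

/-- The metric `d_∞(θ¹,θ²) = ∑_i 2^{-i-1} d(θ¹(i),θ²(i))` on `Θ^{ℕ₀}`. -/
noncomputable def dInfty {Θ : Type*} [PseudoMetricSpace Θ] (a b : ℕ → Θ) : ℝ :=
  ∑' i : ℕ, (2 : ℝ)⁻¹ ^ (i + 1) * dist (a i) (b i)

/-- Measurable functions on `Θ^{ℕ₀}` that are `1`-Lipschitz for the metric `d_∞`. -/
def BLoneSeq (Θ : Type*) [MeasurableSpace Θ] [PseudoMetricSpace Θ] : Set ((ℕ → Θ) → ℝ) :=
  {f | Measurable f ∧ ∀ a b : ℕ → Θ, |f a - f b| ≤ dInfty a b}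

/-- The bounded Lipschitz distance `w_∞` on (probability) measures on `Θ^{ℕ₀}`,
induced by the metric `d_∞`. -/
noncomputable def blDistInfty {Θ : Type*} [MeasurableSpace Θ] [PseudoMetricSpace Θ]
    (M N : Measure (ℕ → Θ)) : ℝ :=
  ⨆ f ∈ BLoneSeq Θ, |∫ θ, f θ ∂M - ∫ θ, f θ ∂N|

theorem integral_norm_Lp_two_le {α : Type*} [MeasurableSpace α] {μ : Measure α}
    [IsProbabilityMeasure μ] (u : Lp ℝ 2 μ) : ∫ x, |u x| ∂μ ≤ ‖u‖ := by
  have h := eLpNorm_le_eLpNorm_of_exponent_le (μ := μ) (p := 1) (q := 2) (by norm_num)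
    (Lp.aestronglyMeasurable u)
  rw [Lp.norm_def]
  simp only [← Real.norm_eq_abs]
  rw [integral_norm_eq_lintegral_enorm (Lp.aestronglyMeasurable u),
    ← eLpNorm_one_eq_lintegral_enorm]
  exact ENNReal.toReal_mono (Lp.eLpNorm_ne_top u) h

/-- Mean ergodic theorem in `L¹` for a square-integrable observable of an ergodic map. -/
theorem Ergodic.tendsto_integral_abs_average_sub {α : Type*} [MeasurableSpace α] {μ : Measure α}
    [IsProbabilityMeasure μ] {T : α → α} (hT : Ergodic T μ) {f : α → ℝ} (hf : MemLp f 2 μ) :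
    Tendsto (fun k : ℕ => ∫ x, |(k : ℝ)⁻¹ * ∑ i ∈ Finset.range k, f (T^[i] x) - ∫ y, f y ∂μ| ∂μ)
      atTop (𝓝 0) := by
  have hTm := hT.toMeasurePreserving
  obtain ⟨U, hU, hUnorm⟩ : ∃ U : Lp ℝ 2 μ →L[ℝ] Lp ℝ 2 μ,
      (∀ u, U u = Lp.compMeasurePreserving T hTm u) ∧ ‖U‖ ≤ 1 :=
    ⟨(Lp.compMeasurePreservingₗᵢ ℝ T hTm).toContinuousLinearMap, fun _ => rfl,
      LinearIsometry.norm_toContinuousLinearMap_le _⟩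
  have hlim := U.tendsto_birkhoffAverage_orthogonalProjection hUnorm (hf.toLp f)
  set p := (U.eqLocus (1 : Lp ℝ 2 μ →L[ℝ] Lp ℝ 2 μ)).orthogonalProjectionOnto (hf.toLp f)
  have hfix : Lp.compMeasurePreserving T hTm (p : Lp ℝ 2 μ) = p :=
    (hU p).symm.trans p.2
  obtain ⟨c, hc⟩ := hT.ae_eq_const_of_ae_eq_comp_ae (Lp.aestronglyMeasurable (p : Lp ℝ 2 μ))
    ((Lp.coeFn_compMeasurePreserving (p : Lp ℝ 2 μ) hTm).symm.trans (by rw [hfix]))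
  have hiter (i : ℕ) : (U^[i] (hf.toLp f) : α → ℝ) =ᵐ[μ] f ∘ T^[i] := by
    induction i with
    | zero => simpa using hf.coeFn_toLp
    | succ i ih =>
      rw [Function.iterate_succ_apply', Function.iterate_succ, ← Function.comp_assoc, hU]
      exact (Lp.coeFn_compMeasurePreserving _ hTm).trans
        (hTm.quasiMeasurePreserving.ae_eq_comp ih)
  have havg (k : ℕ) : ((birkhoffAverage ℝ U _root_.id k (hf.toLp f) : Lp ℝ 2 μ) : α → ℝ) =ᵐ[μ]
      fun x => (k : ℝ)⁻¹ * ∑ i ∈ Finset.range k, f (T^[i] x) := by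
    have hall := ae_all_iff.2 hiter
    have hsum := Lp.coeFn_finsetSum (Finset.range k) (fun i => U^[i] (hf.toLp f))
    filter_upwards [hall, hsum, Lp.coeFn_smul (k : ℝ)⁻¹
      (∑ i ∈ Finset.range k, U^[i] (hf.toLp f))] with x h1 h2 h3
    simp only [birkhoffAverage, birkhoffSum, _root_.id]
    rw [h3, Pi.smul_apply, h2, smul_eq_mul]
    simp [h1]
  have hL1 : Tendsto (fun k : ℕ =>
      ∫ x, |(k : ℝ)⁻¹ * ∑ i ∈ Finset.range k, f (T^[i] x) - c| ∂μ) atTop (𝓝 0) := by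
    refine squeeze_zero (fun k => integral_nonneg fun x => abs_nonneg _) (fun k => ?_)
      (tendsto_iff_norm_sub_tendsto_zero.1 hlim)
    refine le_trans (le_of_eq (integral_congr_ae ?_)) (integral_norm_Lp_two_le _)
    filter_upwards [havg k, hc, Lp.coeFn_sub (birkhoffAverage ℝ U _root_.id k (hf.toLp f))
      (p : Lp ℝ 2 μ)] with x h1 h2 h3
    rw [h3, Pi.sub_apply, h1, h2, Function.const_apply]
  have hint : Integrable f μ := hf.integrable (by norm_num)
  have hinti (i : ℕ) : Integrable (fun x => f (T^[i] x)) μ :=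
    (hTm.iterate i).integrable_comp_of_integrable hint
  have hmean (k : ℕ) (hk : k ≠ 0) :
      ∫ x, (k : ℝ)⁻¹ * ∑ i ∈ Finset.range k, f (T^[i] x) ∂μ = ∫ y, f y ∂μ := by
    rw [integral_const_mul, integral_finsetSum _ fun i _ => hinti i]
    have (i : ℕ) : ∫ x, f (T^[i] x) ∂μ = ∫ y, f y ∂μ := by
      conv_rhs => rw [← (hTm.iterate i).map_eq]
      rw [integral_map (hTm.iterate i).measurable.aemeasurable]
      rw [(hTm.iterate i).map_eq]; exact hf.1
    simp [this, hk]
  have hceq : ∫ y, f y ∂μ - c = 0 := by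
    refine abs_nonpos_iff.1 (ge_of_tendsto hL1 ?_)
    filter_upwards [eventually_ne_atTop 0] with k hk
    rw [← hmean k hk]
    have : Integrable (fun x => (k : ℝ)⁻¹ * ∑ i ∈ Finset.range k, f (T^[i] x)) μ :=
      (integrable_finsetSum _ fun i _ => hinti i).const_mul _
    have h := integral_sub this (integrable_const c)
    simp only [integral_const, probReal_univ, smul_eq_mul, one_mul] at h
    rw [← h]
    exact abs_integral_le_integral_abs
  rwa [sub_eq_zero.1 hceq]

section Suprema

variable {ι : Type*} {S : Set ι} {φ : ι → ℝ} {C : ℝ}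

theorem Real.biSup_le_of_forall_le (hC : 0 ≤ C) (h : ∀ i ∈ S, φ i ≤ C) : ⨆ i ∈ S, φ i ≤ C :=
  Real.iSup_le (fun i => Real.iSup_le (h i) hC) hC

theorem Real.le_biSup_of_forall_le (hC : 0 ≤ C) (h : ∀ i ∈ S, φ i ≤ C) {i : ι} (hi : i ∈ S) :
    φ i ≤ ⨆ i ∈ S, φ i := by
  have hbdd : BddAbove (Set.range fun i => ⨆ _ : i ∈ S, φ i) :=
    ⟨C, by rintro _ ⟨j, rfl⟩; exact Real.iSup_le (h j) hC⟩
  refine le_trans (le_of_eq ?_) (le_ciSup hbdd i)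
  simp [hi]

end Suprema

section Oscillation

variable {α : Type*} [MeasurableSpace α] {f : α → ℝ}

theorem integrable_of_oscillation_le_one (hf : Measurable f) (h : ∀ s t, |f s - f t| ≤ 1)
    (μ : Measure α) [IsProbabilityMeasure μ] : Integrable f μ := by
  obtain ⟨x₀⟩ := μ.nonempty_of_neZero
  refine Integrable.of_bound hf.aestronglyMeasurable (|f x₀| + 1) (ae_of_all _ fun x => ?_)
  rw [Real.norm_eq_abs]
  linarith [h x x₀, abs_sub_abs_le_abs_sub (f x) (f x₀)]

theorem abs_sub_integral_le_one (hf : Measurable f) (h : ∀ s t, |f s - f t| ≤ 1)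
    (μ : Measure α) [IsProbabilityMeasure μ] (x : α) : |f x - ∫ y, f y ∂μ| ≤ 1 := by
  have hi := integrable_of_oscillation_le_one hf h μ
  have : f x - ∫ y, f y ∂μ = ∫ y, (f x - f y) ∂μ := by
    rw [integral_sub (integrable_const _) hi]; simp
  rw [this, ← Real.norm_eq_abs]
  simpa using norm_integral_le_of_norm_le_const (μ := μ)
    (f := fun y => f x - f y) (C := 1) (ae_of_all _ fun y => h x y)

theorem abs_integral_sub_integral_le_two (hf : Measurable f) (h : ∀ s t, |f s - f t| ≤ 1)
    (μ ν : Measure α) [IsProbabilityMeasure μ] [IsProbabilityMeasure ν] :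
    |∫ x, f x ∂μ - ∫ x, f x ∂ν| ≤ 2 := by
  obtain ⟨x₀⟩ := μ.nonempty_of_neZero
  have h1 := abs_le.1 (abs_sub_integral_le_one hf h μ x₀)
  have h2 := abs_le.1 (abs_sub_integral_le_one hf h ν x₀)
  rw [abs_le]
  constructor <;> linarith

end Oscillation

theorem measurable_shift {Θ : Type*} [MeasurableSpace Θ] :
    Measurable (shift : (ℕ → Θ) → ℕ → Θ) :=
  measurable_pi_lambda _ fun i => measurable_pi_apply (i + 1)

theorem shift_iterate_apply {Θ : Type*} (j : ℕ) (θ : ℕ → Θ) (i : ℕ) :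
    (shift^[j] θ) i = θ (i + j) := by
  induction j generalizing θ with
  | zero => rfl
  | succ j ih => rw [Function.iterate_succ_apply, ih]; simp only [shift]; congr 1

section Empirical

variable {Θ : Type*} [MeasurableSpace Θ]

theorem isProbabilityMeasure_emp (θ : ℕ → Θ) {m : ℕ} (hm : m ≠ 0) :
    IsProbabilityMeasure (emp θ m) := by
  constructor
  simp only [emp, Measure.smul_apply, Measure.finsetSum_apply, measure_univ, Finset.sum_const,
    Finset.card_range, smul_eq_mul, nsmul_eq_mul, mul_one]
  exact ENNReal.inv_mul_cancel (by exact_mod_cast hm) (ENNReal.natCast_ne_top m)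

theorem integral_emp (θ : ℕ → Θ) (m : ℕ) {f : Θ → ℝ} (hf : Measurable f) :
    ∫ x, f x ∂(emp θ m) = (m : ℝ)⁻¹ * ∑ i ∈ Finset.range m, f (θ i) := by
  rw [emp, integral_smul_measure, integral_finsetSum_measure]
  · simp [integral_dirac' _ _ hf.stronglyMeasurable]
  · exact fun i _ => integrable_dirac' hf.stronglyMeasurable (by simp)

theorem tendsto_integral_abs_integral_emp_sub {M : Measure (ℕ → Θ)} [IsProbabilityMeasure M]
    (hM : Ergodic shift M) {g : Θ → ℝ} (hg : Measurable g) (hb : ∀ x, |g x| ≤ 1) :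
    Tendsto (fun k : ℕ => ∫ θ, |∫ x, g x ∂(emp θ k) - ∫ x, g x ∂(M.map fun θ => θ 0)| ∂M)
      atTop (𝓝 0) := by
  have hm : Measurable fun θ : ℕ → Θ => θ 0 := measurable_pi_apply 0
  have hmem : MemLp (fun θ : ℕ → Θ => g (θ 0)) 2 M :=
    MemLp.of_bound (hg.comp hm).aestronglyMeasurable 1 (ae_of_all _ fun θ => hb _)
  simpa [integral_emp _ _ hg, integral_map hm.aemeasurable hg.aestronglyMeasurable,
    shift_iterate_apply] using hM.tendsto_integral_abs_average_sub hmem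

theorem integrable_abs_integral_emp_sub (M : Measure (ℕ → Θ)) [IsProbabilityMeasure M]
    {g : Θ → ℝ} (hg : Measurable g) (hb : ∀ x, |g x| ≤ 1) (k : ℕ) (c : ℝ) :
    Integrable (fun θ : ℕ → Θ => |∫ x, g x ∂(emp θ k) - c|) M := by
  simp only [integral_emp _ _ hg]
  refine (((integrable_finsetSum _ fun i _ => ?_).const_mul _).sub (integrable_const c)).abs
  exact Integrable.of_bound (hg.comp (measurable_pi_apply i)).aestronglyMeasurable 1
    (ae_of_all _ fun θ => hb _)

end Empirical

section SequenceMetric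

variable {Θ : Type*} [MetricSpace Θ]

theorem hasSum_half_pow_succ : HasSum (fun i : ℕ => (2 : ℝ)⁻¹ ^ (i + 1)) 1 := by
  have := (hasSum_geometric_of_lt_one (r := (2 : ℝ)⁻¹) (by norm_num) (by norm_num)).mul_left 2⁻¹
  norm_num at this
  simpa [pow_succ'] using this

theorem half_pow_mul_dist_le (hd : ∀ s t : Θ, dist s t ≤ 1) (a b : ℕ → Θ) (i : ℕ) :
    (2 : ℝ)⁻¹ ^ (i + 1) * dist (a i) (b i) ≤ (2 : ℝ)⁻¹ ^ (i + 1) :=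
  mul_le_of_le_one_right (by positivity) (hd _ _)

theorem summable_half_pow_mul_dist (hd : ∀ s t : Θ, dist s t ≤ 1) (a b : ℕ → Θ) :
    Summable fun i : ℕ => (2 : ℝ)⁻¹ ^ (i + 1) * dist (a i) (b i) :=
  Summable.of_nonneg_of_le (fun _ => by positivity) (half_pow_mul_dist_le hd a b)
    hasSum_half_pow_succ.summable

theorem dInfty_nonneg (a b : ℕ → Θ) : 0 ≤ dInfty a b :=
  tsum_nonneg fun _ => by positivity

theorem dInfty_le_one (hd : ∀ s t : Θ, dist s t ≤ 1) (a b : ℕ → Θ) : dInfty a b ≤ 1 :=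
  (Summable.tsum_le_tsum (half_pow_mul_dist_le hd a b) (summable_half_pow_mul_dist hd a b)
    hasSum_half_pow_succ.summable).trans_eq hasSum_half_pow_succ.tsum_eq

theorem dist_le_two_pow_mul_dInfty (hd : ∀ s t : Θ, dist s t ≤ 1) (a b : ℕ → Θ) (i : ℕ) :
    dist (a i) (b i) ≤ 2 ^ (i + 1) * dInfty a b := by
  have h := (summable_half_pow_mul_dist hd a b).le_tsum i fun _ _ => by positivity
  calc dist (a i) (b i) = 2 ^ (i + 1) * ((2 : ℝ)⁻¹ ^ (i + 1) * dist (a i) (b i)) := by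
        rw [← mul_assoc, ← mul_pow]; norm_num
    _ ≤ _ := by gcongr; exact h

theorem continuous_dInfty_right (hd : ∀ s t : Θ, dist s t ≤ 1) (a : ℕ → Θ) :
    Continuous fun b => dInfty a b := by
  refine continuous_tsum (fun i => by fun_prop) hasSum_half_pow_succ.summable fun i b => ?_
  rw [Real.norm_of_nonneg (by positivity)]
  exact half_pow_mul_dist_le hd a b i

theorem dInfty_self (a : ℕ → Θ) : dInfty a a = 0 := by simp [dInfty]

theorem dInfty_comm (a b : ℕ → Θ) : dInfty a b = dInfty b a := by
  simp only [dInfty, dist_comm]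

theorem continuous_of_abs_sub_le_dInfty (hd : ∀ s t : Θ, dist s t ≤ 1) {F : (ℕ → Θ) → ℝ} {K : ℝ}
    (hF : ∀ a b, |F a - F b| ≤ K * dInfty a b) : Continuous F := by
  refine continuous_iff_continuousAt.2 fun a => ?_
  have h0 : Tendsto (fun b => K * dInfty a b) (𝓝 a) (𝓝 0) := by
    have := ((continuous_dInfty_right hd a).tendsto a).const_mul K
    rwa [dInfty_self, mul_zero] at this
  refine tendsto_iff_norm_sub_tendsto_zero.2 (squeeze_zero (fun _ => norm_nonneg _)
    (fun b => ?_) h0)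
  rw [norm_sub_rev]
  exact hF a b

end SequenceMetric

section BoundedLipschitz

variable {Θ : Type*} [MetricSpace Θ] [MeasurableSpace Θ]

theorem oscillation_le_one_of_mem_BLone (hd : ∀ s t : Θ, dist s t ≤ 1) {f : Θ → ℝ}
    (hf : f ∈ BLone Θ) (s t : Θ) : |f s - f t| ≤ 1 :=
  (hf.2 s t).trans (hd s t)

theorem oscillation_le_one_of_mem_BLoneSeq (hd : ∀ s t : Θ, dist s t ≤ 1) {f : (ℕ → Θ) → ℝ}
    (hf : f ∈ BLoneSeq Θ) (a b : ℕ → Θ) : |f a - f b| ≤ 1 :=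
  (hf.2 a b).trans (dInfty_le_one hd a b)

theorem blDist_nonneg (μ ν : Measure Θ) : 0 ≤ blDist μ ν :=
  Real.iSup_nonneg fun _ => Real.iSup_nonneg fun _ => abs_nonneg _

theorem blDistInfty_nonneg (μ ν : Measure (ℕ → Θ)) : 0 ≤ blDistInfty μ ν :=
  Real.iSup_nonneg fun _ => Real.iSup_nonneg fun _ => abs_nonneg _

theorem abs_integral_sub_le_blDist (hd : ∀ s t : Θ, dist s t ≤ 1) (μ ν : Measure Θ)
    [IsProbabilityMeasure μ] [IsProbabilityMeasure ν] {f : Θ → ℝ} (hf : f ∈ BLone Θ) :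
    |∫ x, f x ∂μ - ∫ x, f x ∂ν| ≤ blDist μ ν :=
  Real.le_biSup_of_forall_le (φ := fun f : Θ → ℝ => |∫ x, f x ∂μ - ∫ x, f x ∂ν|) zero_le_two
    (fun _ hg => abs_integral_sub_integral_le_two hg.1
      (oscillation_le_one_of_mem_BLone hd hg) μ ν) hf

theorem abs_integral_sub_le_blDistInfty (hd : ∀ s t : Θ, dist s t ≤ 1) (M N : Measure (ℕ → Θ))
    [IsProbabilityMeasure M] [IsProbabilityMeasure N] {f : (ℕ → Θ) → ℝ} (hf : f ∈ BLoneSeq Θ) :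
    |∫ θ, f θ ∂M - ∫ θ, f θ ∂N| ≤ blDistInfty M N :=
  Real.le_biSup_of_forall_le (φ := fun f : (ℕ → Θ) → ℝ => |∫ θ, f θ ∂M - ∫ θ, f θ ∂N|) zero_le_two
    (fun _ hg => abs_integral_sub_integral_le_two hg.1
      (oscillation_le_one_of_mem_BLoneSeq hd hg) M N) hf

theorem blDist_le_two (hd : ∀ s t : Θ, dist s t ≤ 1) (μ ν : Measure Θ)
    [IsProbabilityMeasure μ] [IsProbabilityMeasure ν] : blDist μ ν ≤ 2 :=
  Real.biSup_le_of_forall_le zero_le_two fun _ hg => abs_integral_sub_integral_le_two hg.1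
    (oscillation_le_one_of_mem_BLone hd hg) μ ν

theorem blDistInfty_le_two (hd : ∀ s t : Θ, dist s t ≤ 1) (M N : Measure (ℕ → Θ))
    [IsProbabilityMeasure M] [IsProbabilityMeasure N] : blDistInfty M N ≤ 2 :=
  Real.biSup_le_of_forall_le zero_le_two fun _ hg => abs_integral_sub_integral_le_two hg.1
    (oscillation_le_one_of_mem_BLoneSeq hd hg) M N

theorem blDist_comm (μ ν : Measure Θ) : blDist μ ν = blDist ν μ := by
  simp only [blDist, abs_sub_comm]

theorem blDist_triangle (hd : ∀ s t : Θ, dist s t ≤ 1) (μ ν ρ : Measure Θ)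
    [IsProbabilityMeasure μ] [IsProbabilityMeasure ν] [IsProbabilityMeasure ρ] :
    blDist μ ρ ≤ blDist μ ν + blDist ν ρ := by
  refine Real.biSup_le_of_forall_le (add_nonneg (blDist_nonneg _ _) (blDist_nonneg _ _))
    fun f hf => (abs_sub_le _ (∫ x, f x ∂ν) _).trans ?_
  exact add_le_add (abs_integral_sub_le_blDist hd μ ν hf) (abs_integral_sub_le_blDist hd ν ρ hf)

theorem blDist_map_eval_zero_le (hd : ∀ s t : Θ, dist s t ≤ 1) (M N : Measure (ℕ → Θ))
    [IsProbabilityMeasure M] [IsProbabilityMeasure N] :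
    blDist (M.map fun θ => θ 0) (N.map fun θ => θ 0) ≤ 2 * blDistInfty M N := by
  refine Real.biSup_le_of_forall_le (mul_nonneg zero_le_two (blDistInfty_nonneg _ _))
    fun f hf => ?_
  have hm : Measurable fun θ : ℕ → Θ => θ 0 := measurable_pi_apply 0
  have hmem : (fun θ : ℕ → Θ => 2⁻¹ * f (θ 0)) ∈ BLoneSeq Θ := by
    refine ⟨(hf.1.comp hm).const_mul _, fun a b => ?_⟩
    rw [← mul_sub, abs_mul, abs_of_pos (by norm_num : (0 : ℝ) < 2⁻¹)]
    have := dist_le_two_pow_mul_dInfty hd a b 0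
    rw [zero_add, pow_one] at this
    linarith [hf.2 (a 0) (b 0)]
  have h := abs_integral_sub_le_blDistInfty hd M N hmem
  rw [integral_const_mul, integral_const_mul, ← mul_sub, abs_mul,
    abs_of_pos (by norm_num : (0 : ℝ) < 2⁻¹)] at h
  rw [integral_map hm.aemeasurable hf.1.aestronglyMeasurable,
    integral_map hm.aemeasurable hf.1.aestronglyMeasurable]
  linarith

/-- The distance of the empirical distribution of `m` points to `ν` is controlled by the average,
over the first `m` shifts, of the distances of the empirical distributions of `k` points. -/
theorem blDist_emp_le_average (hd : ∀ s t : Θ, dist s t ≤ 1) (ν : Measure Θ)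
    [IsProbabilityMeasure ν] (θ : ℕ → Θ) {k m : ℕ} (hk : k ≠ 0) (hm : m ≠ 0) :
    blDist (emp θ m) ν ≤
      (m : ℝ)⁻¹ * ∑ j ∈ Finset.range m, blDist (emp (shift^[j] θ) k) ν + 2 * k / m := by
  have hnn : 0 ≤ (m : ℝ)⁻¹ * ∑ j ∈ Finset.range m, blDist (emp (shift^[j] θ) k) ν :=
    mul_nonneg (by positivity) (Finset.sum_nonneg fun _ _ => blDist_nonneg _ _)
  have hm0 : (0 : ℝ) < m := by positivity
  have hk0 : (0 : ℝ) < k := by positivity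
  refine Real.biSup_le_of_forall_le (by positivity) fun f hf => ?_
  set c := ∫ x, f x ∂ν
  set g : ℕ → ℝ := fun i => f (θ i) - c with hg
  have hg1 (i : ℕ) : |g i| ≤ 1 :=
    abs_sub_integral_le_one hf.1 (oscillation_le_one_of_mem_BLone hd hf) ν (θ i)
  have hemp : ∫ x, f x ∂(emp θ m) - c = (m : ℝ)⁻¹ * ∑ i ∈ Finset.range m, g i := by
    rw [integral_emp θ m hf.1, hg, Finset.sum_sub_distrib]
    simp only [Finset.sum_const, Finset.card_range, nsmul_eq_mul]
    field_simp
  have hblock (j : ℕ) : |(k : ℝ)⁻¹ * ∑ i ∈ Finset.range k, g (i + j)| ≤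
      blDist (emp (shift^[j] θ) k) ν := by
    have := isProbabilityMeasure_emp (shift^[j] θ) hk
    refine le_trans (le_of_eq ?_) (abs_integral_sub_le_blDist hd (emp (shift^[j] θ) k) ν hf)
    congr 1
    rw [integral_emp _ k hf.1, hg, Finset.sum_sub_distrib]
    simp only [Finset.sum_const, Finset.card_range, nsmul_eq_mul, shift_iterate_apply]
    field_simp
    rfl
  clear_value g
  have hshift (i : ℕ) :
      |∑ j ∈ Finset.range m, g j - ∑ j ∈ Finset.range m, g (i + j)| ≤ 2 * i := by
    induction i with
    | zero => simp
    | succ i ih =>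
      have hstep : ∑ j ∈ Finset.range m, g (i + 1 + j) =
          ∑ j ∈ Finset.range m, g (i + j) + g (i + m) - g i := by
        have h1 := Finset.sum_range_succ (fun j => g (i + j)) m
        have h2 := Finset.sum_range_succ' (fun j => g (i + j)) m
        have h3 : ∑ j ∈ Finset.range m, g (i + 1 + j) =
            ∑ j ∈ Finset.range m, g (i + (j + 1)) :=
          Finset.sum_congr rfl fun j _ => by congr 1; ring
        simp only [add_zero] at h2
        linarith
      have h1 := abs_le.1 (hg1 i)
      have h2 := abs_le.1 (hg1 (i + m))
      have h3 := abs_le.1 ih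
      rw [hstep, abs_le]
      push_cast
      constructor <;> linarith
  have hdouble : |∑ j ∈ Finset.range m, g j -
      ∑ j ∈ Finset.range m, (k : ℝ)⁻¹ * ∑ i ∈ Finset.range k, g (i + j)| ≤ 2 * k := by
    have : ∑ j ∈ Finset.range m, g j -
        ∑ j ∈ Finset.range m, (k : ℝ)⁻¹ * ∑ i ∈ Finset.range k, g (i + j) =
        (k : ℝ)⁻¹ * ∑ i ∈ Finset.range k,
          (∑ j ∈ Finset.range m, g j - ∑ j ∈ Finset.range m, g (i + j)) := by
      rw [Finset.sum_sub_distrib, ← Finset.mul_sum, Finset.sum_comm]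
      simp only [Finset.sum_const, Finset.card_range, nsmul_eq_mul]
      field_simp
    rw [this, abs_mul, abs_of_pos (inv_pos.2 hk0)]
    calc (k : ℝ)⁻¹ * |∑ i ∈ Finset.range k,
          (∑ j ∈ Finset.range m, g j - ∑ j ∈ Finset.range m, g (i + j))|
        ≤ (k : ℝ)⁻¹ * ∑ _i ∈ Finset.range k, (2 * k : ℝ) := by
          gcongr
          refine (Finset.abs_sum_le_sum_abs _ _).trans (Finset.sum_le_sum fun i hi => ?_)
          have : (i : ℝ) ≤ k := by exact_mod_cast (Finset.mem_range.1 hi).le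
          linarith [hshift i]
      _ = 2 * k := by simp; field_simp
  rw [hemp, abs_mul, abs_of_pos (inv_pos.2 hm0)]
  have htotal : |∑ i ∈ Finset.range m, g i| ≤
      ∑ j ∈ Finset.range m, blDist (emp (shift^[j] θ) k) ν + 2 * k := by
    have h1 := (Finset.abs_sum_le_sum_abs
      (fun j => (k : ℝ)⁻¹ * ∑ i ∈ Finset.range k, g (i + j)) (Finset.range m)).trans
      (Finset.sum_le_sum fun j _ => hblock j)
    have h2 := abs_sub_abs_le_abs_sub (∑ j ∈ Finset.range m, g j)
      (∑ j ∈ Finset.range m, (k : ℝ)⁻¹ * ∑ i ∈ Finset.range k, g (i + j))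
    linarith
  calc (m : ℝ)⁻¹ * |∑ i ∈ Finset.range m, g i|
      ≤ (m : ℝ)⁻¹ * (∑ j ∈ Finset.range m, blDist (emp (shift^[j] θ) k) ν + 2 * k) := by gcongr
    _ = _ := by ring

theorem blDist_emp_sub_le (hd : ∀ s t : Θ, dist s t ≤ 1) (ν : Measure Θ)
    [IsProbabilityMeasure ν] {k : ℕ} (hk : k ≠ 0) (a b : ℕ → Θ) :
    blDist (emp a k) ν ≤ blDist (emp b k) ν + 2 ^ k * dInfty a b := by
  have := isProbabilityMeasure_emp b hk
  refine Real.biSup_le_of_forall_le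
    (add_nonneg (blDist_nonneg _ _) (mul_nonneg (by positivity) (dInfty_nonneg a b))) fun f hf => ?_
  have h1 := abs_integral_sub_le_blDist hd (emp b k) ν hf
  have h2 := abs_sub_le (∫ x, f x ∂(emp a k)) (∫ x, f x ∂(emp b k)) (∫ x, f x ∂ν)
  suffices |∫ x, f x ∂(emp a k) - ∫ x, f x ∂(emp b k)| ≤ 2 ^ k * dInfty a b by linarith
  have hk0 : (0 : ℝ) < k := by positivity
  rw [integral_emp a k hf.1, integral_emp b k hf.1, ← mul_sub, ← Finset.sum_sub_distrib, abs_mul,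
    abs_of_pos (inv_pos.2 hk0)]
  calc (k : ℝ)⁻¹ * |∑ i ∈ Finset.range k, (f (a i) - f (b i))|
      ≤ (k : ℝ)⁻¹ * ∑ _i ∈ Finset.range k, 2 ^ k * dInfty a b := by
        gcongr
        refine (Finset.abs_sum_le_sum_abs _ _).trans (Finset.sum_le_sum fun i hi => ?_)
        refine ((hf.2 _ _).trans (dist_le_two_pow_mul_dInfty hd a b i)).trans ?_
        gcongr
        · exact dInfty_nonneg a b
        · norm_num
        · exact Finset.mem_range.1 hi
    _ = 2 ^ k * dInfty a b := by simp; field_simp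

theorem abs_blDist_emp_sub_le (hd : ∀ s t : Θ, dist s t ≤ 1) (ν : Measure Θ)
    [IsProbabilityMeasure ν] {k : ℕ} (hk : k ≠ 0) (a b : ℕ → Θ) :
    |blDist (emp a k) ν - blDist (emp b k) ν| ≤ 2 ^ k * dInfty a b := by
  have h1 := blDist_emp_sub_le hd ν hk a b
  have h2 := blDist_emp_sub_le hd ν hk b a
  rw [dInfty_comm b a] at h2
  rw [abs_le]
  constructor <;> linarith

variable [BorelSpace Θ] [SecondCountableTopology Θ]

theorem measurable_blDist_emp (hd : ∀ s t : Θ, dist s t ≤ 1) (ν : Measure Θ)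
    [IsProbabilityMeasure ν] {k : ℕ} (hk : k ≠ 0) : Measurable fun θ => blDist (emp θ k) ν :=
  (continuous_of_abs_sub_le_dInfty hd (abs_blDist_emp_sub_le hd ν hk)).measurable

theorem integrable_blDist_emp (hd : ∀ s t : Θ, dist s t ≤ 1) (ν : Measure Θ)
    [IsProbabilityMeasure ν] {k : ℕ} (hk : k ≠ 0) (M : Measure (ℕ → Θ)) [IsProbabilityMeasure M] :
    Integrable (fun θ => blDist (emp θ k) ν) M := by
  refine Integrable.of_bound (measurable_blDist_emp hd ν hk).aestronglyMeasurable 2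
    (ae_of_all _ fun θ => ?_)
  have := isProbabilityMeasure_emp θ hk
  rw [Real.norm_of_nonneg (blDist_nonneg _ _)]
  exact blDist_le_two hd _ _

theorem integral_blDist_emp_le_of_shift_invariant (hd : ∀ s t : Θ, dist s t ≤ 1) (ν : Measure Θ)
    [IsProbabilityMeasure ν] {k m : ℕ} (hk : k ≠ 0) (hm : m ≠ 0) (M : Measure (ℕ → Θ))
    [IsProbabilityMeasure M] (hM : M.map shift = M) :
    ∫ θ, blDist (emp θ m) ν ∂M ≤ ∫ θ, blDist (emp θ k) ν ∂M + 2 * k / m := by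
  have hpres : MeasurePreserving shift M M := ⟨measurable_shift, hM⟩
  have hint (j : ℕ) : Integrable (fun θ => blDist (emp (shift^[j] θ) k) ν) M :=
    (hpres.iterate j).integrable_comp_of_integrable (integrable_blDist_emp hd ν hk M)
  have hsum := (integrable_finsetSum (Finset.range m) fun j _ => hint j).const_mul (m : ℝ)⁻¹
  have heq (j : ℕ) : ∫ θ, blDist (emp (shift^[j] θ) k) ν ∂M = ∫ θ, blDist (emp θ k) ν ∂M := by
    conv_rhs => rw [← (hpres.iterate j).map_eq]
    rw [integral_map (hpres.iterate j).measurable.aemeasurable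
      (measurable_blDist_emp hd ν hk).aestronglyMeasurable]
  refine (integral_mono (integrable_blDist_emp hd ν hm M) (hsum.add (integrable_const _))
    fun θ => blDist_emp_le_average hd ν θ hk hm).trans_eq ?_
  simp only [Pi.add_apply]
  rw [integral_add hsum (integrable_const _), integral_const_mul,
    integral_finsetSum _ fun j _ => hint j]
  simp [heq, hm]

theorem integral_blDist_emp_le_add_blDistInfty (hd : ∀ s t : Θ, dist s t ≤ 1) (ν : Measure Θ)
    [IsProbabilityMeasure ν] {k : ℕ} (hk : k ≠ 0) (M N : Measure (ℕ → Θ))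
    [IsProbabilityMeasure M] [IsProbabilityMeasure N] :
    ∫ θ, blDist (emp θ k) ν ∂M ≤ ∫ θ, blDist (emp θ k) ν ∂N + 2 ^ k * blDistInfty M N := by
  have hpow : (0 : ℝ) < 2 ^ k := by positivity
  have hmem : (fun θ => ((2 : ℝ) ^ k)⁻¹ * blDist (emp θ k) ν) ∈ BLoneSeq Θ := by
    refine ⟨(measurable_blDist_emp hd ν hk).const_mul _, fun a b => ?_⟩
    rw [← mul_sub, abs_mul, abs_of_pos (inv_pos.2 hpow), inv_mul_le_iff₀ hpow]
    exact abs_blDist_emp_sub_le hd ν hk a b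
  have h := abs_integral_sub_le_blDistInfty hd M N hmem
  rw [integral_const_mul, integral_const_mul, ← mul_sub, abs_mul, abs_of_pos (inv_pos.2 hpow),
    inv_mul_le_iff₀ hpow] at h
  linarith [le_abs_self (∫ θ, blDist (emp θ k) ν ∂M - ∫ θ, blDist (emp θ k) ν ∂N)]

end BoundedLipschitz

section Discretization

variable {Θ : Type*} [MetricSpace Θ] [MeasurableSpace Θ] [BorelSpace Θ]
  [SecondCountableTopology Θ]

theorem measurable_dist_simpleFunc (q : SimpleFunc Θ Θ) : Measurable fun x => dist x (q x) :=
  measurable_id.dist q.measurable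

theorem integrable_dist_simpleFunc (hd : ∀ s t : Θ, dist s t ≤ 1) (q : SimpleFunc Θ Θ)
    (μ : Measure Θ) [IsProbabilityMeasure μ] : Integrable (fun x => dist x (q x)) μ := by
  refine Integrable.of_bound (measurable_dist_simpleFunc q).aestronglyMeasurable 1
    (ae_of_all _ fun x => ?_)
  rw [Real.norm_of_nonneg dist_nonneg]
  exact hd _ _

/-- Comparison of the bounded Lipschitz distance with finitely many integrals, obtained by
quantizing the space with a simple function `q`. -/
theorem blDist_le_of_simpleFunc (hd : ∀ s t : Θ, dist s t ≤ 1) (q : SimpleFunc Θ Θ)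
    (μ ν : Measure Θ) [IsProbabilityMeasure μ] [IsProbabilityMeasure ν] :
    blDist μ ν ≤ 2 * ∫ x, dist x (q x) ∂ν +
      (|∫ x, dist x (q x) ∂μ - ∫ x, dist x (q x) ∂ν| +
        ∑ t ∈ q.range, |∫ x, (q ⁻¹' {t}).indicator (fun _ => (1 : ℝ)) x ∂μ -
          ∫ x, (q ⁻¹' {t}).indicator (fun _ => (1 : ℝ)) x ∂ν|) := by
  have hnn : 0 ≤ ∫ x, dist x (q x) ∂ν := integral_nonneg fun _ => dist_nonneg
  have hsnn : 0 ≤ ∑ t ∈ q.range, |∫ x, (q ⁻¹' {t}).indicator (fun _ => (1 : ℝ)) x ∂μ -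
      ∫ x, (q ⁻¹' {t}).indicator (fun _ => (1 : ℝ)) x ∂ν| :=
    Finset.sum_nonneg fun _ _ => abs_nonneg _
  refine Real.biSup_le_of_forall_le (by positivity) fun f hf => ?_
  obtain ⟨x₀⟩ := μ.nonempty_of_neZero
  set h : Θ → ℝ := fun x => f x - f x₀ with hh
  have hosc := oscillation_le_one_of_mem_BLone hd hf
  have hh1 (x : Θ) : |h x| ≤ 1 := hosc x x₀
  have hpart (x : Θ) : h (q x) =
      ∑ t ∈ q.range, h t * (q ⁻¹' {t}).indicator (fun _ => (1 : ℝ)) x := by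
    rw [Finset.sum_eq_single_of_mem (q x) (q.mem_range_self x)]
    · simp
    · intro t _ ht
      rw [Set.indicator_of_notMem, mul_zero]
      exact fun hx => ht hx.symm
  have hindint (t : Θ) (ρ : Measure Θ) [IsProbabilityMeasure ρ] :
      Integrable ((q ⁻¹' {t}).indicator fun _ => (1 : ℝ)) ρ :=
    (integrable_const 1).indicator (q.measurableSet_preimage _)
  have hhq (ρ : Measure Θ) [IsProbabilityMeasure ρ] : Integrable (fun x => h (q x)) ρ := by
    simp only [hpart]
    exact integrable_finsetSum _ fun t _ => (hindint t ρ).const_mul _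
  have hfint (ρ : Measure Θ) [IsProbabilityMeasure ρ] : Integrable f ρ :=
    integrable_of_oscillation_le_one hf.1 hosc ρ
  have hhint (ρ : Measure Θ) [IsProbabilityMeasure ρ] : Integrable h ρ :=
    (hfint ρ).sub (integrable_const _)
  have hq (ρ : Measure Θ) [IsProbabilityMeasure ρ] : ∫ x, h (q x) ∂ρ =
      ∑ t ∈ q.range, h t * ∫ x, (q ⁻¹' {t}).indicator (fun _ => (1 : ℝ)) x ∂ρ := by
    simp only [hpart]
    rw [integral_finsetSum _ fun t _ => (hindint t ρ).const_mul _]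
    simp only [integral_const_mul]
  have happrox (ρ : Measure Θ) [IsProbabilityMeasure ρ] :
      |∫ x, h x ∂ρ - ∫ x, h (q x) ∂ρ| ≤ ∫ x, dist x (q x) ∂ρ := by
    rw [← integral_sub (hhint ρ) (hhq ρ)]
    refine abs_integral_le_integral_abs.trans (integral_mono ((hhint ρ).sub (hhq ρ)).abs
      (integrable_dist_simpleFunc hd q ρ) fun x => ?_)
    simpa [hh] using hf.2 x (q x)
  have hfinite : |∫ x, h (q x) ∂μ - ∫ x, h (q x) ∂ν| ≤
      ∑ t ∈ q.range, |∫ x, (q ⁻¹' {t}).indicator (fun _ => (1 : ℝ)) x ∂μ -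
        ∫ x, (q ⁻¹' {t}).indicator (fun _ => (1 : ℝ)) x ∂ν| := by
    rw [hq μ, hq ν, ← Finset.sum_sub_distrib]
    refine (Finset.abs_sum_le_sum_abs _ _).trans (Finset.sum_le_sum fun t _ => ?_)
    rw [← mul_sub, abs_mul]
    exact mul_le_of_le_one_left (abs_nonneg _) (hh1 t)
  have hshift (ρ : Measure Θ) [IsProbabilityMeasure ρ] : ∫ x, h x ∂ρ = ∫ x, f x ∂ρ - f x₀ := by
    rw [hh, integral_sub (hfint ρ) (integrable_const _)]
    simp
  have h1 := abs_le.1 (happrox μ)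
  have h2 := abs_le.1 (happrox ν)
  have h3 := abs_le.1 hfinite
  have h4 := le_abs_self (∫ x, dist x (q x) ∂μ - ∫ x, dist x (q x) ∂ν)
  rw [hshift μ] at h1
  rw [hshift ν] at h2
  rw [abs_le]
  constructor <;> linarith

theorem exists_simpleFunc_integral_dist_lt (hd : ∀ s t : Θ, dist s t ≤ 1) (ν : Measure Θ)
    [IsProbabilityMeasure ν] {ε : ℝ} (hε : 0 < ε) :
    ∃ q : SimpleFunc Θ Θ, ∫ x, dist x (q x) ∂ν < ε := by
  have := ν.nonempty_of_neZero
  let e := TopologicalSpace.denseSeq Θ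
  have h : Tendsto (fun N => ∫ x, dist x (SimpleFunc.nearestPt e N x) ∂ν) atTop
      (𝓝 (∫ _, (0 : ℝ) ∂ν)) := by
    refine tendsto_integral_of_dominated_convergence (fun _ => 1)
      (fun N => (measurable_dist_simpleFunc _).aestronglyMeasurable) (integrable_const 1)
      (fun N => ae_of_all _ fun x => ?_) (ae_of_all _ fun x => ?_)
    · rw [Real.norm_of_nonneg dist_nonneg]
      exact hd _ _
    · have hx := SimpleFunc.tendsto_nearestPt (e := e) (x := x)
        ((TopologicalSpace.denseRange_denseSeq Θ) x)
      simpa using (tendsto_const_nhds (x := x)).dist hx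
  rw [integral_zero] at h
  obtain ⟨N, hN⟩ := (h.eventually_lt_const hε).exists
  exact ⟨_, hN⟩

theorem tendsto_integral_blDist_emp (hd : ∀ s t : Θ, dist s t ≤ 1) {M : Measure (ℕ → Θ)}
    [IsProbabilityMeasure M] (hM : Ergodic shift M) :
    Tendsto (fun k : ℕ => ∫ θ, blDist (emp θ k) (M.map fun θ => θ 0) ∂M) atTop (𝓝 0) := by
  set ν := M.map fun θ : ℕ → Θ => θ 0 with hν
  have : IsProbabilityMeasure ν :=
    Measure.isProbabilityMeasure_map (measurable_pi_apply 0).aemeasurable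
  refine tendsto_order.2 ⟨fun a ha => Eventually.of_forall fun k =>
    ha.trans_le (integral_nonneg fun θ => blDist_nonneg _ _), fun ε hε => ?_⟩
  obtain ⟨q, hq⟩ := exists_simpleFunc_integral_dist_lt hd ν (half_pos hε)
  have hdm := measurable_dist_simpleFunc q
  have hdb (x : Θ) : |dist x (q x)| ≤ 1 := by
    rw [abs_of_nonneg dist_nonneg]; exact hd _ _
  have him (t : Θ) : Measurable ((q ⁻¹' {t}).indicator fun _ => (1 : ℝ)) :=
    measurable_const.indicator (q.measurableSet_preimage _)
  have hib (t x : Θ) : |(q ⁻¹' {t}).indicator (fun _ => (1 : ℝ)) x| ≤ 1 := by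
    by_cases hx : x ∈ q ⁻¹' {t} <;> simp [hx]
  have hlim := ((tendsto_integral_abs_integral_emp_sub hM hdm hdb).add
    (tendsto_finsetSum q.range fun t _ =>
      tendsto_integral_abs_integral_emp_sub hM (him t) (hib t))).const_add
    (2 * ∫ x, dist x (q x) ∂ν)
  rw [← hν] at hlim
  have hlt : 2 * ∫ x, dist x (q x) ∂ν + (0 + ∑ _t ∈ q.range, (0 : ℝ)) < ε := by
    rw [Finset.sum_const_zero]; linarith
  filter_upwards [hlim.eventually_lt_const hlt, eventually_ne_atTop 0] with k hk hk0
  refine lt_of_le_of_lt ?_ hk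
  have hi1 := integrable_abs_integral_emp_sub M hdm hdb k (∫ x, dist x (q x) ∂ν)
  have hi2 (t : Θ) := integrable_abs_integral_emp_sub M (him t) (hib t) k
    (∫ x, (q ⁻¹' {t}).indicator (fun _ => (1 : ℝ)) x ∂ν)
  have hi3 := integrable_finsetSum q.range fun t _ => hi2 t
  refine (integral_mono (integrable_blDist_emp hd ν hk0 M)
    ((integrable_const (2 * ∫ x, dist x (q x) ∂ν)).add (hi1.add hi3)) fun θ => ?_).trans_eq ?_
  · have := isProbabilityMeasure_emp θ hk0
    exact blDist_le_of_simpleFunc hd q (emp θ k) ν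
  · rw [integral_add' (integrable_const _) (hi1.add hi3), integral_add' hi1 hi3,
      integral_finsetSum _ fun t _ => hi2 t]
    simp

end Discretization

section Measurability

variable {Θ : Type*} [MetricSpace Θ] [MeasurableSpace Θ] [SecondCountableTopology Θ]

/-- The class `BLoneSeq Θ` is separable for pointwise convergence. -/
theorem exists_seq_pointwise_dense_BLoneSeq [Nonempty Θ] (hd : ∀ s t : Θ, dist s t ≤ 1) :
    ∃ F : ℕ → (ℕ → Θ) → ℝ, (∀ j, F j ∈ BLoneSeq Θ) ∧ ∀ f ∈ BLoneSeq Θ, ∃ φ : ℕ → ℕ,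
      ∀ a, Tendsto (fun l => F (φ l) a) atTop (𝓝 (f a)) := by
  let e := TopologicalSpace.denseSeq (ℕ → Θ)
  let R : Set (ℕ → ℝ) := (fun f : (ℕ → Θ) → ℝ => fun i => f (e i)) '' BLoneSeq Θ
  have hzero : (fun _ => 0 : (ℕ → Θ) → ℝ) ∈ BLoneSeq Θ :=
    ⟨measurable_const, fun a b => by simpa using dInfty_nonneg a b⟩
  have : Nonempty R := ⟨⟨_, _, hzero, rfl⟩⟩
  choose F hF hFe using fun j => (TopologicalSpace.denseSeq R j).2
  refine ⟨F, hF, fun f hf => ?_⟩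
  have hmem := TopologicalSpace.denseRange_denseSeq R ⟨_, f, hf, rfl⟩
  obtain ⟨x, hx, hlim⟩ := mem_closure_iff_seq_limit.1 hmem
  choose φ hφ using hx
  refine ⟨φ, fun a => ?_⟩
  have hpt (i : ℕ) : Tendsto (fun l => F (φ l) (e i)) atTop (𝓝 (f (e i))) := by
    have h := tendsto_pi_nhds.1 ((continuous_subtype_val.tendsto _).comp hlim) i
    refine h.congr fun l => ?_
    rw [Function.comp_apply, ← hφ l]
    exact (congrFun (hFe (φ l)) i).symm
  refine Metric.tendsto_atTop.2 fun ε hε => ?_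
  have hnear : {b | dInfty a b < ε / 3} ∈ 𝓝 a :=
    (continuous_dInfty_right hd a).continuousAt.eventually_lt_const
      (by simpa [dInfty_self] using hε)
  obtain ⟨i, hi⟩ := (TopologicalSpace.denseRange_denseSeq (ℕ → Θ)).exists_mem_open isOpen_interior
    ⟨a, mem_interior_iff_mem_nhds.2 hnear⟩
  have hi' : e i ∈ {b | dInfty a b < ε / 3} := interior_subset hi
  rw [Set.mem_ofPred_eq] at hi'
  obtain ⟨L, hL⟩ := Metric.tendsto_atTop.1 (hpt i) (ε / 3) (by positivity)
  refine ⟨L, fun l hl => ?_⟩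
  have h1 := hL l hl
  rw [Real.dist_eq] at h1 ⊢
  have h2 := abs_le.1 ((hF (φ l)).2 a (e i))
  have h3 := abs_le.1 (hf.2 a (e i))
  have h4 := abs_lt.1 h1
  rw [abs_lt]
  constructor <;> linarith

theorem measurable_blDistInfty_kernel (hd : ∀ s t : Θ, dist s t ≤ 1) {X : Type*}
    [MeasurableSpace X] (κ : Kernel X (ℕ → Θ)) [IsMarkovKernel κ] (N : Measure (ℕ → Θ))
    [IsProbabilityMeasure N] : Measurable fun x => blDistInfty (κ x) N := by
  obtain ⟨θ₀⟩ := N.nonempty_of_neZero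
  have : Nonempty Θ := ⟨θ₀ 0⟩
  obtain ⟨F, hF, hdense⟩ := exists_seq_pointwise_dense_BLoneSeq hd
  have heq (x : X) : blDistInfty (κ x) N = ⨆ j, |∫ θ, F j θ ∂(κ x) - ∫ θ, F j θ ∂N| := by
    have hbdd : BddAbove (Set.range fun j => |∫ θ, F j θ ∂(κ x) - ∫ θ, F j θ ∂N|) :=
      ⟨blDistInfty (κ x) N, by
        rintro _ ⟨j, rfl⟩; exact abs_integral_sub_le_blDistInfty hd _ _ (hF j)⟩
    refine le_antisymm (Real.biSup_le_of_forall_le (Real.iSup_nonneg fun _ => abs_nonneg _)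
      fun f hf => ?_) (ciSup_le fun j => abs_integral_sub_le_blDistInfty hd _ _ (hF j))
    obtain ⟨φ, hφ⟩ := hdense f hf
    obtain ⟨C, hC⟩ := (hφ θ₀).abs.bddAbove_range
    have hint (ρ : Measure (ℕ → Θ)) [IsProbabilityMeasure ρ] :
        Tendsto (fun l => ∫ θ, F (φ l) θ ∂ρ) atTop (𝓝 (∫ θ, f θ ∂ρ)) := by
      refine tendsto_integral_of_dominated_convergence (fun _ => C + 1)
        (fun l => (hF _).1.aestronglyMeasurable) (integrable_const _)
        (fun l => ae_of_all _ fun θ => ?_) (ae_of_all _ hφ)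
      have h1 := oscillation_le_one_of_mem_BLoneSeq hd (hF (φ l)) θ θ₀
      have h2 : |F (φ l) θ₀| ≤ C := hC ⟨l, rfl⟩
      rw [Real.norm_eq_abs]
      linarith [abs_sub_abs_le_abs_sub (F (φ l) θ) (F (φ l) θ₀)]
    exact le_of_tendsto ((hint (κ x)).sub (hint N)).abs
      (Eventually.of_forall fun l => le_ciSup hbdd (φ l))
  simp only [heq]
  refine Measurable.iSup fun j => ?_
  have h : Measurable fun x => ∫ θ, F j θ ∂(κ x) :=
    ((hF j).1.stronglyMeasurable.integral_kernel).measurable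
  exact (h.sub measurable_const).abs

theorem integrable_blDistInfty_kernel (hd : ∀ s t : Θ, dist s t ≤ 1) {X : Type*}
    [MeasurableSpace X] (P : Measure X) [IsProbabilityMeasure P] (κ : Kernel X (ℕ → Θ))
    [IsMarkovKernel κ] (N : Measure (ℕ → Θ)) [IsProbabilityMeasure N] :
    Integrable (fun x => blDistInfty (κ x) N) P := by
  refine Integrable.of_bound (measurable_blDistInfty_kernel hd κ N).aestronglyMeasurable 2
    (ae_of_all _ fun x => ?_)
  rw [Real.norm_of_nonneg (blDistInfty_nonneg _ _)]
  exact blDistInfty_le_two hd _ _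

end Measurability

/-- Random version of the stationary consistency result: if the random
stationary Monte Carlo measures `M_n(x,·)` converge in averaged `w_∞` distance to a
stationary ergodic `M_∞` with invariant marginal `Π_∞`, then the averaged risks along any
`m_n → ∞` tend to `0`. -/
theorem random_stationary_consistent {Θ : Type*} [MetricSpace Θ] [CompleteSpace Θ]
    [TopologicalSpace.SeparableSpace Θ] [MeasurableSpace Θ] [BorelSpace Θ]
    (hd : ∀ s t : Θ, dist s t ≤ 1)
    {X : ℕ → Type*} [∀ n, MeasurableSpace (X n)]
    (P : ∀ n, Measure (X n)) [∀ n, IsProbabilityMeasure (P n)]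
    (M : ∀ n, Kernel (X n) (ℕ → Θ)) [∀ n, IsMarkovKernel (M n)]
    (target : ∀ n, Kernel (X n) Θ)
    (hstat : ∀ n, ∀ᵐ x ∂(P n),
      (M n x).map shift = M n x ∧ (M n x).map (fun θ => θ 0) = target n x)
    (Minf : Measure (ℕ → Θ)) [IsProbabilityMeasure Minf]
    (hergodic : Ergodic shift Minf)
    (targetinf : Measure Θ) (htargetinf : targetinf = Minf.map fun θ => θ 0)
    (hconv : Tendsto (fun n => ∫ x, blDistInfty (M n x) Minf ∂(P n)) atTop (𝓝 0))
    (mseq : ℕ → ℕ) (hmseq : Tendsto mseq atTop atTop) :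
    Tendsto (fun n => ∫ x, ∫ θ, blDist (emp θ (mseq n)) (target n x) ∂(M n x) ∂(P n))
      atTop (𝓝 0) := by
  have : SecondCountableTopology Θ := UniformSpace.secondCountable_of_separable Θ
  obtain rfl := htargetinf
  set ν := Minf.map fun θ : ℕ → Θ => θ 0
  have hmeas : Measurable fun θ : ℕ → Θ => θ 0 := measurable_pi_apply 0
  have : IsProbabilityMeasure ν := Measure.isProbabilityMeasure_map hmeas.aemeasurable
  -- the averaged risk is controlled through blocks of an arbitrary fixed length
  have hbound (k : ℕ) (hk : k ≠ 0) (n : ℕ) (hn : mseq n ≠ 0) :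
      ∫ x, ∫ θ, blDist (emp θ (mseq n)) (target n x) ∂(M n x) ∂(P n) ≤
        ∫ θ, blDist (emp θ k) ν ∂Minf + 2 * k / mseq n +
          (2 ^ k + 2) * ∫ x, blDistInfty (M n x) Minf ∂(P n) := by
    have hint := (integrable_blDistInfty_kernel hd (P n) (M n) Minf).const_mul (2 ^ k + 2)
    refine (integral_mono_of_nonneg
      (ae_of_all _ fun x => integral_nonneg fun θ => blDist_nonneg _ _)
      ((integrable_const (∫ θ, blDist (emp θ k) ν ∂Minf + 2 * k / mseq n)).add hint)
      ?_).trans_eq ?_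
    · filter_upwards [hstat n] with x hx
      obtain ⟨hinv, htarget⟩ := hx
      have : IsProbabilityMeasure (target n x) := by
        rw [← htarget]; exact Measure.isProbabilityMeasure_map hmeas.aemeasurable
      have htri : ∫ θ, blDist (emp θ (mseq n)) (target n x) ∂(M n x) ≤
          ∫ θ, blDist (emp θ (mseq n)) ν ∂(M n x) + blDist ν (target n x) := by
        refine (integral_mono (integrable_blDist_emp hd _ hn _)
          ((integrable_blDist_emp hd ν hn _).add (integrable_const (blDist ν (target n x))))
          fun θ => ?_).trans_eq ?_
        · have := isProbabilityMeasure_emp θ hn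
          exact blDist_triangle hd _ _ _
        · simp only [Pi.add_apply]
          rw [integral_add (integrable_blDist_emp hd ν hn _) (integrable_const _)]
          simp
      have hmarginal : blDist ν (target n x) ≤ 2 * blDistInfty (M n x) Minf := by
        rw [← htarget, blDist_comm]
        exact blDist_map_eval_zero_le hd _ _
      have h1 := integral_blDist_emp_le_of_shift_invariant hd ν hk hn (M n x) hinv
      have h2 := integral_blDist_emp_le_add_blDistInfty hd ν hk (M n x) Minf
      simp only [Pi.add_apply]
      linarith
    · simp only [Pi.add_apply]
      rw [integral_add (integrable_const _) hint, integral_const_mul]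
      simp
  refine tendsto_order.2 ⟨fun a ha => Eventually.of_forall fun n => ha.trans_le
    (integral_nonneg fun x => integral_nonneg fun θ => blDist_nonneg _ _), fun ε hε => ?_⟩
  obtain ⟨k, hkε, hk⟩ := (((tendsto_integral_blDist_emp hd hergodic).eventually_lt_const hε).and
    (eventually_ne_atTop 0)).exists
  have hlim : Tendsto (fun n => ∫ θ, blDist (emp θ k) ν ∂Minf + 2 * k / mseq n +
      (2 ^ k + 2) * ∫ x, blDistInfty (M n x) Minf ∂(P n)) atTop
      (𝓝 (∫ θ, blDist (emp θ k) ν ∂Minf + 0 + (2 ^ k + 2) * 0)) :=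
    (((tendsto_natCast_atTop_atTop.comp hmseq).const_div_atTop (2 * k : ℝ)).const_add _).add
      (hconv.const_mul _)
  filter_upwards [hlim.eventually_lt_const (by simpa using hkε), hmseq.eventually_ne_atTop 0]
    with n hn hn0
  exact (hbound k hk n hn0).trans_lt hn
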